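/- arXiv:1707.03231 — 2 statements merged into one kernel-verified Lean document; each statement's English description precedes it below -/
import Mathlib

section
/- The discriminant Δ(y) = det(f_{i,j}(y)) is a squarefree homogeneous polynomial in k[y₀,…,y_n] of degree 2(a₀+a₁+a₂) + 3e. -/
/-!
Statement 6 (Lemma 2.2 (2) / `lem:P` of Frei–Loughran): for a smooth hypersurface
`X` of bidegree `(e,2)` in `F_n(a₀,a₁,a₂)`, the discriminant `Δ(y) = det (f_{i,j}(y))`
is a squarefree homogeneous polynomial of degree `2(a₀+a₁+a₂) + 3e`.
-/

noncomputable section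

open MvPolynomial

namespace Stmt

variable (k : Type) [Field k] [CharZero k] (n : ℕ)

variable {k n}

/-- The defining polynomial `Q = ∑_{i,j} f_{i,j}(y) xᵢxⱼ` in the variables
`y₀, …, y_n, x₀, x₁, x₂`. -/
def Qk (f : Fin 3 → Fin 3 → MvPolynomial (Fin (n + 1)) k) :
    MvPolynomial (Fin (n + 1) ⊕ Fin 3) k :=
  ∑ i : Fin 3, ∑ j : Fin 3, rename Sum.inl (f i j) * X (Sum.inr i) * X (Sum.inr j)

/-- Smoothness of the hypersurface `X : Q = 0` in `F_n(a₀,a₁,a₂)`: at every point over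
an algebraic closure of `k` with `y ≠ 0`, `x ≠ 0` and `Q(y,x) = 0`, some partial
derivative of `Q` is nonzero. -/
def IsSmoothX (f : Fin 3 → Fin 3 → MvPolynomial (Fin (n + 1)) k) : Prop :=
  ∀ y : Fin (n + 1) → AlgebraicClosure k, ∀ x : Fin 3 → AlgebraicClosure k,
    y ≠ 0 → x ≠ 0 → aeval (Sum.elim y x) (Qk f) = 0 →
      ∃ s, aeval (Sum.elim y x) (pderiv s (Qk f)) ≠ 0

/-- The coefficients `f_{i,j}` are symmetric and homogeneous of degree `aᵢ + aⱼ + e`,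
so that `Q` is bihomogeneous of bidegree `(e,2)` on `F_n(a₀,a₁,a₂)`. -/
def DegOK (a : Fin 3 → ℤ) (e : ℤ) (f : Fin 3 → Fin 3 → MvPolynomial (Fin (n + 1)) k) : Prop :=
  ∀ i j, f i j = f j i ∧ (f i j).IsHomogeneous (a i + a j + e).toNat ∧
    (a i + a j + e < 0 → f i j = 0)

theorem smooth_aux {k : Type} [Field k] [CharZero k] {n : ℕ}
    (f : Fin 3 → Fin 3 → MvPolynomial (Fin (n + 1)) k) (hs : ∀ i j, f i j = f j i)
    (hsm : IsSmoothX f) (y : Fin (n + 1) → AlgebraicClosure k) (x : Fin 3 → AlgebraicClosure k)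
    (hy : y ≠ 0) (hx : x ≠ 0) (h1 : ∀ a, ∑ b, aeval y (f a b) * x b = 0)
    (h2 : ∀ s, ∑ a, ∑ b, aeval y (pderiv s (f a b)) * x a * x b = 0) : False := by
  have e : ∀ p : MvPolynomial (Fin (n + 1)) k,
      aeval (Sum.elim y x) (rename (Sum.inl : _ → Fin (n + 1) ⊕ Fin 3) p) = aeval y p := by
    intro p
    rw [aeval_rename]
    rfl
  have hq : aeval (Sum.elim y x) (Qk f) = 0 := by
    have : aeval (Sum.elim y x) (Qk f) = ∑ a, x a * ∑ b, aeval y (f a b) * x b := by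
      simp only [Qk, map_sum, map_mul, e, aeval_X, Sum.elim_inr, Finset.mul_sum]
      refine Finset.sum_congr rfl fun a _ => Finset.sum_congr rfl fun b _ => ?_
      ring
    rw [this]
    simp [h1]
  obtain ⟨s, hs'⟩ := hsm y x hy hx hq
  apply hs'
  rcases s with s | s
  · rw [← h2 s]
    simp only [Qk, map_sum, Derivation.leibniz, smul_eq_mul, map_add, map_mul, e, aeval_X,
      Sum.elim_inr, pderiv_rename Sum.inl_injective]
    refine Finset.sum_congr rfl fun a _ => Finset.sum_congr rfl fun b _ => ?_
    simp [pderiv_X]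
    ring
  · have hz : ∀ p : MvPolynomial (Fin (n + 1)) k,
        pderiv (Sum.inr s : Fin (n + 1) ⊕ Fin 3) (rename Sum.inl p) = 0 := by
      intro p
      apply pderiv_eq_zero_of_notMem_vars
      intro h
      have := vars_rename _ _ h
      simp at this
    have : aeval (Sum.elim y x) (pderiv (Sum.inr s) (Qk f))
        = ∑ b, aeval y (f s b) * x b + ∑ b, aeval y (f s b) * x b := by
      simp only [Qk, map_sum, Derivation.leibniz, smul_eq_mul, map_add, map_mul, e, aeval_X,
        Sum.elim_inr, hz]
      have h10 := hs 1 0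
      have h20 := hs 2 0
      have h21 := hs 2 1
      fin_cases s <;> simp [Fin.sum_univ_three, pderiv_X, Pi.single_apply, h10, h20, h21] <;> ring
    rw [this, h1 s]
    simp

theorem key_aux {K : Type*} [Field K] {n : ℕ}
    (M : Fin 3 → Fin 3 → MvPolynomial (Fin (n + 1)) K) (hs : ∀ i j, M i j = M j i)
    (hsm : ∀ (y : Fin (n + 1) → K) (x : Fin 3 → K), y ≠ 0 → x ≠ 0 →
      (∀ a, ∑ b, eval y (M a b) * x b = 0) →
      (∀ s, ∑ a, ∑ b, eval y (pderiv s (M a b)) * x a * x b = 0) → False)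
    (p : MvPolynomial (Fin (n + 1)) K) (u v : Fin 3 → MvPolynomial (Fin (n + 1)) K)
    (huv : ∀ a, ∑ b, M a b * v b = p * u a)
    (y : Fin (n + 1) → K) (hy : y ≠ 0) (hp : eval y p = 0)
    (hv : ∃ a, eval y (v a) ≠ 0) (h0 : ∑ a, eval y (v a) * eval y (u a) = 0) : False := by
  have hM : ∀ a, ∑ b, eval y (M a b) * eval y (v b) = 0 := by
    intro a
    have := congrArg (eval y) (huv a)
    simpa [hp] using this
  refine hsm y (fun a => eval y (v a)) hy ?_ hM ?_
  · obtain ⟨a, ha⟩ := hv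
    intro h
    exact ha (congrFun h a)
  · intro s
    have hd : ∀ a, ∑ b, (eval y (M a b) * eval y (pderiv s (v b))
        + eval y (v b) * eval y (pderiv s (M a b))) = eval y (u a) * eval y (pderiv s p) := by
      intro a
      have := congrArg (fun q => eval y (pderiv s q)) (huv a)
      simpa [hp, Derivation.leibniz] using this
    have d0 := hd 0
    have d1 := hd 1
    have d2 := hd 2
    have m0 := hM 0
    have m1 := hM 1
    have m2 := hM 2
    simp only [Fin.sum_univ_three, hs 1 0, hs 2 0, hs 2 1] at d0 d1 d2 m0 m1 m2 h0 ⊢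
    linear_combination eval y (v 0) * d0 + eval y (v 1) * d1 + eval y (v 2) * d2
      - eval y (pderiv s (v 0)) * m0 - eval y (pderiv s (v 1)) * m1
      - eval y (pderiv s (v 2)) * m2 + eval y (pderiv s p) * h0

theorem binary_aux {K : Type*} [Field K] [CharZero K] [IsAlgClosed K] (A B C : K) :
    ∃ s t : K, (s ≠ 0 ∨ t ≠ 0) ∧ A * s * s + B * s * t + C * t * t = 0 := by
  by_cases hA : A = 0
  · exact ⟨1, 0, by simp, by simp [hA]⟩
  · obtain ⟨r, hr⟩ := IsAlgClosed.exists_pow_nat_eq (B ^ 2 - 4 * A * C) (n := 2) (by norm_num)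
    refine ⟨r - B, 2 * A, Or.inr (by simpa using hA), ?_⟩
    linear_combination A * hr

theorem quad_aux {K : Type*} [Field K] [CharZero K] [IsAlgClosed K] (N : Fin 3 → Fin 3 → K)
    (i : Fin 3) : ∃ w : Fin 3 → K, w i = 0 ∧ (∃ a, a ≠ i ∧ w a ≠ 0) ∧
      ∑ a, w a * ∑ b, N a b * w b = 0 := by
  have main : ∀ j l : Fin 3, i ≠ j → i ≠ l → j ≠ l → ∃ w : Fin 3 → K, w i = 0 ∧
      (∃ a, a ≠ i ∧ w a ≠ 0) ∧ ∑ a, w a * ∑ b, N a b * w b = 0 := by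
    intro j l hij hil hjl
    obtain ⟨s, t, hst, h⟩ := binary_aux (N j j) (N j l + N l j) (N l l)
    refine ⟨fun a => if a = j then s else if a = l then t else 0, by simp [hij, hil], ?_, ?_⟩
    · rcases hst with h | h
      · exact ⟨j, hij.symm, by simpa using h⟩
      · exact ⟨l, hil.symm, by simpa [hjl.symm] using h⟩
    · refine Eq.trans ?_ h
      fin_cases i <;> fin_cases j <;> fin_cases l <;>
        simp [Fin.sum_univ_three] at hij hil hjl ⊢ <;> ring
  fin_cases i
  · exact main 1 2 (by decide) (by decide) (by decide)
  · exact main 0 2 (by decide) (by decide) (by decide)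
  · exact main 0 1 (by decide) (by decide) (by decide)

theorem point_aux {K : Type*} [Field K] [IsAlgClosed K] {n : ℕ} (hn : 1 ≤ n)
    (p h : MvPolynomial (Fin (n + 1)) K) (hp : Prime p) (hh : ¬ p ∣ h) :
    ∃ y : Fin (n + 1) → K, y ≠ 0 ∧ eval y p = 0 ∧ eval y h ≠ 0 := by
  have hX : ∃ i : Fin (n + 1), ¬ p ∣ X i := by
    by_contra! hc
    have h0 := hc ⟨0, by omega⟩
    have h1 := hc ⟨1, by omega⟩
    have a0 := (hp.irreducible.associated_of_dvd (X_prime (R := K)).irreducible h0)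
    have a1 := (hp.irreducible.associated_of_dvd (X_prime (R := K)).irreducible h1)
    have := (a0.symm.trans a1).dvd
    rw [X_dvd_X] at this
    simp at this
  obtain ⟨i, hi⟩ := hX
  have hph : ¬ p ∣ h * X i := fun hd => (hp.dvd_or_dvd hd).elim hh hi
  have hP : (Ideal.span {p}).IsPrime := (Ideal.span_singleton_prime hp.ne_zero).2 hp
  have hv := IsPrime.vanishingIdeal_zeroLocus (K := K) (Ideal.span {p})
  have hmem : h * X i ∉ Ideal.span {p} := by rwa [Ideal.mem_span_singleton]
  rw [← hv, mem_vanishingIdeal_iff] at hmem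
  push Not at hmem
  obtain ⟨y, hy, hyh⟩ := hmem
  rw [zeroLocus_span] at hy
  have hyp := hy p rfl
  simp only [coe_aeval_eq_eval, map_mul, eval_X] at hyp hyh
  refine ⟨y, ?_, hyp, left_ne_zero_of_mul hyh⟩
  rintro rfl
  simp at hyh

theorem main_aux {K : Type*} [Field K] [CharZero K] [IsAlgClosed K] {n : ℕ} (hn : 1 ≤ n)
    (M : Fin 3 → Fin 3 → MvPolynomial (Fin (n + 1)) K) (hs : ∀ i j, M i j = M j i)
    (hsm : ∀ (y : Fin (n + 1) → K) (x : Fin 3 → K), y ≠ 0 → x ≠ 0 →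
      (∀ a, ∑ b, eval y (M a b) * x b = 0) →
      (∀ s, ∑ a, ∑ b, eval y (pderiv s (M a b)) * x a * x b = 0) → False)
    (p : MvPolynomial (Fin (n + 1)) K) (hp : Prime p)
    (hd : p * p ∣ Matrix.det (Matrix.of M)) : False := by
  classical
  by_cases hA : ∃ i j, ¬ p ∣ (Matrix.of M).adjugate i j
  · obtain ⟨i, j, hij⟩ := hA
    obtain ⟨y, hy, hyp, hyh⟩ := point_aux hn p _ hp hij
    obtain ⟨q, hq⟩ := hd
    refine key_aux M hs hsm p (fun a => if a = j then p * q else 0)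
      (fun a => (Matrix.of M).adjugate a j) ?_ y hy hyp ⟨i, hyh⟩ ?_
    · intro a
      have := congrFun (congrFun (Matrix.mul_adjugate (Matrix.of M)) a) j
      rw [Matrix.mul_apply] at this
      simp only [Matrix.of_apply] at this
      rw [this, hq, Matrix.smul_apply, Matrix.one_apply]
      split_ifs <;> simp [mul_assoc]
    · refine Finset.sum_eq_zero fun a _ => ?_
      split_ifs <;> simp [hyp]
  push Not at hA
  have hmin : ∀ i a b, p ∣ M i i * M a b - M i b * M a i := by
    have A := fun i j => hA i j
    simp only [Matrix.adjugate_fin_three] at A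
    have a00 := A 0 0
    have a01 := A 0 1
    have a02 := A 0 2
    have a11 := A 1 1
    have a12 := A 1 2
    have a22 := A 2 2
    simp [hs 1 0, hs 2 0, hs 2 1] at a00 a01 a02 a11 a12 a22
    have t1 : ∀ x z, p ∣ x → z = x → p ∣ z := fun x z h e => e ▸ h
    have t2 : ∀ x z, p ∣ x → z = -x → p ∣ z := fun x z h e => e ▸ (dvd_neg.2 h)
    have t3 : ∀ z, z = 0 → p ∣ z := fun z e => e ▸ dvd_zero p
    have all3 : ∀ P : Fin 3 → Prop, P 0 → P 1 → P 2 → ∀ i, P i := by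
      intro P h0 h1 h2 i
      fin_cases i
      exacts [h0, h1, h2]
    refine all3 _ ?_ ?_ ?_ <;> refine all3 _ ?_ ?_ ?_ <;> refine all3 _ ?_ ?_ ?_ <;>
    (try simp only [hs 1 0, hs 2 0, hs 2 1]) <;>
    first
    | exact t3 _ (by ring1)
    | exact t1 _ _ a00 (by ring1)
    | exact t1 _ _ a01 (by ring1)
    | exact t1 _ _ a02 (by ring1)
    | exact t1 _ _ a11 (by ring1)
    | exact t1 _ _ a12 (by ring1)
    | exact t1 _ _ a22 (by ring1)
    | exact t2 _ _ a01 (by ring1)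
    | exact t2 _ _ a02 (by ring1)
    | exact t2 _ _ a12 (by ring1)
  by_cases hB : ∃ i, ¬ p ∣ M i i
  · obtain ⟨i, hi⟩ := hB
    obtain ⟨y, hy, hyp, hyh⟩ := point_aux hn p _ hp hi
    choose N hN using hmin i
    have hNi : ∀ b, N i b = 0 := by
      intro b
      have := hN i b
      have h2 : p * N i b = 0 := by rw [← this]; ring
      exact (mul_eq_zero.1 h2).resolve_left hp.ne_zero
    obtain ⟨w, hwi, ⟨c, hci, hwc⟩, hw⟩ := quad_aux (fun a b => eval y (N a b)) i
    refine key_aux M hs hsm p (fun a => ∑ b, N a b * C (w b))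
      (fun a => M i i * C (w a) - if a = i then ∑ b, M i b * C (w b) else 0) ?_ y hy hyp
      ⟨c, by simp [hci, hyh, hwc]⟩ ?_
    · intro a
      simp only [mul_sub, Finset.sum_sub_distrib, mul_ite, mul_zero, Finset.sum_ite_eq',
        Finset.mem_univ, if_true, Finset.mul_sum]
      rw [← Finset.sum_sub_distrib]
      refine Finset.sum_congr rfl fun b _ => ?_
      linear_combination C (w b) * hN a b
    · have : ∀ a, eval y (M i i * C (w a) - if a = i then ∑ b, M i b * C (w b) else 0) *
          eval y (∑ b, N a b * C (w b)) = eval y (M i i) * (w a * ∑ b, eval y (N a b) * w b) := by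
        intro a
        by_cases h : a = i
        · subst h
          simp [hNi]
        · simp [h, mul_assoc]
      simp only [this]
      rw [← Finset.mul_sum, hw, mul_zero]
  push Not at hB
  have hC : ∀ i j, p ∣ M i j := by
    intro i j
    have h1 := hmin i j j
    have h2 : p ∣ M i j * M i j := by
      rw [hs j i] at h1
      have := dvd_sub (Dvd.dvd.mul_right (hB i) (M j j)) h1
      simpa using this
    exact (hp.dvd_or_dvd h2).elim id id
  choose N hN using hC
  have h1 : ¬ p ∣ 1 := fun h => hp.not_unit (isUnit_of_dvd_one h)
  obtain ⟨y, hy, hyp, -⟩ := point_aux hn p 1 hp h1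
  obtain ⟨w, hwi, ⟨c, hci, hwc⟩, hw⟩ := quad_aux (fun a b => eval y (N a b)) 0
  refine key_aux M hs hsm p (fun a => ∑ b, N a b * C (w b)) (fun a => C (w a)) ?_ y hy hyp
    ⟨c, by simpa using hwc⟩ (by simpa using hw)
  intro a
  rw [Finset.mul_sum]
  refine Finset.sum_congr rfl fun b _ => ?_
  rw [hN a b]
  ring

theorem sqf_aux {k : Type} [Field k] [CharZero k] {n : ℕ} (hn : 1 ≤ n)
    (f : Fin 3 → Fin 3 → MvPolynomial (Fin (n + 1)) k) (hs : ∀ i j, f i j = f j i)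
    (hsm : IsSmoothX f) : Squarefree (Matrix.det (Matrix.of f)) := by
  haveI : CharZero (AlgebraicClosure k) := charZero_of_injective_algebraMap
    (algebraMap k (AlgebraicClosure k)).injective
  set φ : MvPolynomial (Fin (n + 1)) k →+* MvPolynomial (Fin (n + 1)) (AlgebraicClosure k) :=
    map (algebraMap k (AlgebraicClosure k)) with hφ
  have hinj : Function.Injective φ := map_injective _ (algebraMap k (AlgebraicClosure k)).injective
  have key : ∀ p, Prime p → ¬ p * p ∣ φ (Matrix.det (Matrix.of f)) := by
    intro p hp hd
    refine main_aux hn (fun i j => φ (f i j)) (fun i j => by rw [hs i j]) ?_ p hp ?_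
    · intro y x hy hx h1 h2
      refine smooth_aux f hs hsm y x hy hx ?_ ?_
      · simpa [hφ, eval_map, aeval_def] using h1
      · simpa [hφ, eval_map, aeval_def, pderiv_map] using h2
    · rw [RingHom.map_det] at hd
      exact hd
  intro g hg
  by_contra hu
  have hg' : φ g * φ g ∣ φ (Matrix.det (Matrix.of f)) := by
    rw [← map_mul]
    exact map_dvd φ hg
  by_cases h0 : φ g = 0
  · rw [h0, zero_mul, zero_dvd_iff] at hg'
    exact key (X 0) X_prime (hg' ▸ dvd_zero _)
  have hu' : ¬ IsUnit (φ g) := by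
    intro h
    rw [isUnit_iff_totalDegree_of_isReduced] at h
    apply hu
    rw [isUnit_iff_totalDegree_of_isReduced]
    refine ⟨?_, ?_⟩
    · have := h.1
      rw [hφ, coeff_map] at this
      rw [isUnit_iff_ne_zero] at this ⊢
      intro h
      simp [h] at this
    · have := h.2
      rw [hφ, totalDegree, support_map_of_injective _
        (algebraMap k (AlgebraicClosure k)).injective] at this
      exact this
  obtain ⟨p, hp, hpg⟩ := WfDvdMonoid.exists_irreducible_factor hu' h0
  exact key p hp.prime ((mul_dvd_mul hpg hpg).trans hg')

/-- Lemma `lem:P` (2): the discriminant polynomial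
`Δ = det (f_{i,j}) ∈ k[y₀,…,y_n]` is squarefree and homogeneous of degree
`2(a₀+a₁+a₂) + 3e`. -/
theorem statement_6
    (k : Type) [Field k] [CharZero k]
    (n : ℕ) (hn : 1 ≤ n)
    (a : Fin 3 → ℤ) (ha : a 0 ≤ a 1 ∧ a 1 ≤ a 2) (e : ℤ)
    (f : Fin 3 → Fin 3 → MvPolynomial (Fin (n + 1)) k)
    (hf : DegOK a e f) (hsmooth : IsSmoothX f) :
    ∃ d : ℕ, (d : ℤ) = 2 * (a 0 + a 1 + a 2) + 3 * e ∧
      Squarefree (Matrix.det (Matrix.of f)) ∧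
      (Matrix.det (Matrix.of f)).IsHomogeneous d := by
  have hsq := sqf_aux hn f (fun i j => (hf i j).1) hsmooth
  have hne : Matrix.det (Matrix.of f) ≠ 0 := hsq.ne_zero
  have hsum : ∀ σ : Equiv.Perm (Fin 3),
      ∑ i, (a (σ i) + a i + e) = 2 * (a 0 + a 1 + a 2) + 3 * e := by
    intro σ
    have := Equiv.sum_comp σ a
    simp only [Finset.sum_add_distrib, this]
    simp [Fin.sum_univ_three]
    ring
  have hterm : ∀ σ : Equiv.Perm (Fin 3), (∏ i, f (σ i) i) = 0 ∨
      ∀ i, 0 ≤ a (σ i) + a i + e := by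
    intro σ
    by_cases h : ∀ i, 0 ≤ a (σ i) + a i + e
    · exact Or.inr h
    · push Not at h
      obtain ⟨i, hi⟩ := h
      exact Or.inl (Finset.prod_eq_zero (Finset.mem_univ i) ((hf (σ i) i).2.2 hi))
  have hpos : 0 ≤ 2 * (a 0 + a 1 + a 2) + 3 * e := by
    by_contra hneg
    apply hne
    rw [Matrix.det_apply]
    refine Finset.sum_eq_zero fun σ _ => ?_
    rcases hterm σ with h | h
    · simp only [Matrix.of_apply, h, smul_zero]
    · exact absurd (hsum σ ▸ Finset.sum_nonneg fun i _ => h i) hneg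
  refine ⟨(2 * (a 0 + a 1 + a 2) + 3 * e).toNat, Int.toNat_of_nonneg hpos, hsq, ?_⟩
  rw [Matrix.det_apply]
  refine IsHomogeneous.sum _ _ _ fun σ _ => ?_
  have hh : (∏ i, f (σ i) i).IsHomogeneous (2 * (a 0 + a 1 + a 2) + 3 * e).toNat := by
    rcases hterm σ with h | h
    · rw [h]
      exact isHomogeneous_zero _ _ _
    · have := IsHomogeneous.prod Finset.univ (fun i => f (σ i) i) _
        (fun i _ => (hf (σ i) i).2.1)
      convert this using 1
      zify
      rw [Int.toNat_of_nonneg hpos, ← hsum σ]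
      exact Finset.sum_congr rfl fun i _ => (Int.toNat_of_nonneg (h i)).symm
  simp only [Matrix.of_apply]
  rcases Int.units_eq_one_or (Equiv.Perm.sign σ) with h | h
  · simpa [h] using hh
  · simpa [h] using hh.neg

end Stmt
end
end

section
/- Let t be an odd integer with t ≡ 1 (mod 4). For n ≥ 1, let N(2ⁿ) = #{(x₀,x₁,x₂) ∈ (ℤ/2ⁿℤ)³ : (x₀,x₁,x₂) ≢ (0,0,0) (mod 2) and x₀² + x₁² ≡ t·x₂² (mod 2ⁿ)}. Then N(2ⁿ) = 2^{2n−6}·N(8) for all n ≥ 3, N(8) = 64, and consequently lim_{n→∞} N(2ⁿ)/2^{2n} = 1. -/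
/-!
Statement 16 (from the proof of the Lemma in §4.2 of Frei–Loughran): computation
of the 2-adic density of the conic `x₀² + x₁² = t·x₂²` for `t ≡ 1 (mod 4)`:
`N(2ⁿ) = 2^{2n-6}·N(8)` for `n ≥ 3`, `N(8) = 64`, and `σ₂ = lim N(2ⁿ)/2^{2n} = 1`.
-/

noncomputable section

open Filter Topology

namespace Stmt

/-- The number of triples `(x₀,x₁,x₂)` modulo `q`, not all divisible by `2`,
satisfying `x₀² + x₁² ≡ t·x₂² (mod q)`. -/
def Ncong (t : ℤ) (q : ℕ) : ℕ :=
  Nat.card {v : Fin 3 → ZMod q //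
    (¬ ∀ i, (2 : ZMod q) ∣ v i) ∧ v 0 ^ 2 + v 1 ^ 2 = (t : ZMod q) * v 2 ^ 2}

open Classical in
def SS (t c : ℤ) (q : ℕ) : Finset (Fin 3 → ZMod (2 ^ q)) :=
  Finset.univ.filter (fun v => (¬ ∀ i, (2 : ZMod (2 ^ q)) ∣ v i) ∧
    v 0 ^ 2 + v 1 ^ 2 - (t : ZMod (2 ^ q)) * v 2 ^ 2 = (c : ZMod (2 ^ q)))

lemma mem_SS (t c : ℤ) (q : ℕ) (v : Fin 3 → ZMod (2 ^ q)) : v ∈ SS t c q ↔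
    (¬ ∀ i, (2 : ZMod (2 ^ q)) ∣ v i) ∧
      v 0 ^ 2 + v 1 ^ 2 - (t : ZMod (2 ^ q)) * v 2 ^ 2 = (c : ZMod (2 ^ q)) := by
  simp [SS]

lemma Ncong_eq (t : ℤ) (q : ℕ) : Ncong t (2 ^ q) = (SS t 0 q).card := by
  unfold Ncong
  rw [← Nat.card_eq_finsetCard]
  refine Nat.card_congr (Equiv.subtypeEquivRight fun v => ?_)
  rw [mem_SS, Int.cast_zero, sub_eq_zero]

lemma two_dvd (n : ℕ) (hn : 1 ≤ n) (a : ℤ) : (2 : ZMod (2 ^ n)) ∣ (a : ZMod (2 ^ n)) ↔ 2 ∣ a := by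
  constructor
  · rintro ⟨c, hc⟩
    obtain ⟨c, rfl⟩ := ZMod.intCast_surjective c
    have h : ((a - 2 * c : ℤ) : ZMod (2 ^ n)) = 0 := by push_cast; rw [hc]; ring
    rw [ZMod.intCast_zmod_eq_zero_iff_dvd] at h
    have h2 : (2 : ℤ) ∣ ((2 ^ n : ℕ) : ℤ) := by
      push_cast; exact dvd_pow_self _ (by omega)
    have := h2.trans h
    omega
  · rintro ⟨c, rfl⟩
    exact ⟨c, by push_cast; ring⟩

lemma mem_int (t c : ℤ) (n : ℕ) (hn : 1 ≤ n) (a : Fin 3 → ℤ) :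
    (fun i => (a i : ZMod (2 ^ n))) ∈ SS t c n ↔
      (¬ ∀ i, 2 ∣ a i) ∧ (2 : ℤ) ^ n ∣ a 0 ^ 2 + a 1 ^ 2 - t * a 2 ^ 2 - c := by
  rw [mem_SS]
  simp only [two_dvd n hn]
  refine and_congr Iff.rfl ?_
  have := ZMod.intCast_zmod_eq_zero_iff_dvd (a 0 ^ 2 + a 1 ^ 2 - t * a 2 ^ 2 - c) (2 ^ n)
  push_cast at this
  rw [← this, sub_eq_zero]

lemma odd2 (t : ℤ) (ht : t ≡ 1 [ZMOD 4]) (a : Fin 3 → ℤ) (h : ¬ ∀ i, 2 ∣ a i)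
    (h4 : 4 ∣ a 0 ^ 2 + a 1 ^ 2 - t * a 2 ^ 2) : ¬ 2 ∣ a 2 := by
  intro h2
  apply h
  obtain ⟨c, hc⟩ := h2
  have h5 : 4 ∣ a 0 ^ 2 + a 1 ^ 2 := by
    have : (4:ℤ) ∣ t * a 2 ^ 2 := ⟨t * c ^ 2, by rw [hc]; ring⟩
    have := dvd_add h4 this
    simpa using this
  have key : ∀ x y : ℤ, 4 ∣ x ^ 2 + y ^ 2 → 2 ∣ x ∧ 2 ∣ y := by
    intro x y hxy
    rcases Int.even_or_odd' x with ⟨k, rfl | rfl⟩ <;> rcases Int.even_or_odd' y with ⟨l, rfl | rfl⟩ <;>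
      ring_nf at hxy <;> omega
  have := key _ _ h5
  intro i
  fin_cases i
  · exact this.1
  · exact this.2
  · exact ⟨c, hc⟩

lemma step_card (t : ℤ) (ht : t ≡ 1 [ZMOD 4]) (n : ℕ) (hn : 3 ≤ n) :
    (SS t 0 (n+1)).card = (SS t (2 ^ n) (n+1)).card := by
  have hself : ∀ c d : ℤ, (2:ℤ) ^ n ∣ c → (2:ℤ)^(n+1) ∣ c + 2 ^ n - d →
      ∀ v ∈ SS t c (n+1), v + Pi.single 2 (((2 ^ (n-1) : ℤ)) : ZMod (2 ^ (n+1))) ∈ SS t d (n+1) := by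
    intro c d hc hd v hv
    obtain ⟨a, rfl⟩ : ∃ a : Fin 3 → ℤ, v = fun i => (a i : ZMod (2 ^ (n+1))) := by
      choose a ha using fun i => ZMod.intCast_surjective (v i)
      exact ⟨a, funext fun i => (ha i).symm⟩
    have e : (fun i => (a i : ZMod (2 ^ (n+1)))) + Pi.single 2 (((2 ^ (n-1) : ℤ)) : ZMod (2 ^ (n+1)))
      = fun i => (((a + Pi.single 2 (2 ^ (n-1)) : Fin 3 → ℤ) i : ℤ) : ZMod (2 ^ (n+1))) := by
      funext i
      fin_cases i <;> simp
    rw [e, mem_int _ _ _ (by omega)]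
    rw [mem_int _ _ _ (by omega)] at hv
    obtain ⟨hp, hq⟩ := hv
    obtain ⟨m, rfl⟩ : ∃ m, n = m + 3 := ⟨n - 3, by omega⟩
    have h4 : (4:ℤ) ∣ a 0 ^ 2 + a 1 ^ 2 - t * a 2 ^ 2 := by
      have h1 : (4:ℤ) ∣ 2 ^ (m+3) := ⟨2 ^ (m+1), by ring⟩
      have h2 : (4:ℤ) ∣ 2 ^ (m+3+1) := ⟨2 ^ (m+2), by ring⟩
      have := dvd_add (h2.trans hq) (h1.trans hc)
      simpa using this
    have ho := odd2 t ht a hp h4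
    constructor
    · intro h
      have := h 2
      apply ho
      have h1 : (2:ℤ) ∣ 2 ^ (m+2) := ⟨2 ^ (m+1), by ring⟩
      simp only [Pi.add_apply, Pi.single_eq_same] at this
      exact (dvd_add_left h1).1 this
    · have e0 : (a + Pi.single 2 (2 ^ (m+3-1)) : Fin 3 → ℤ) 0 = a 0 := by simp
      have e1 : (a + Pi.single 2 (2 ^ (m+3-1)) : Fin 3 → ℤ) 1 = a 1 := by simp
      have e2 : (a + Pi.single 2 (2 ^ (m+3-1)) : Fin 3 → ℤ) 2 = a 2 + 2 ^ (m+2) := by simp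
      rw [e0, e1, e2]
      obtain ⟨x, hx⟩ := hq
      obtain ⟨y, hy⟩ := hd
      obtain ⟨z, hz⟩ : ∃ z, t = 4 * z + 1 := ⟨t / 4, by have := ht; unfold Int.ModEq at this; omega⟩
      obtain ⟨w, hw⟩ : ∃ w, a 2 = 2 * w + 1 := ⟨a 2 / 2, by omega⟩
      have hA : a 0 ^ 2 + a 1 ^ 2 = 2 ^ (m+3+1) * x + c + t * a 2 ^ 2 := by linarith
      have hd' : d = c + 2 ^ (m+3) - 2 ^ (m+3+1) * y := by linarith
      refine ⟨x + y - t * 2 ^ m - t * w - 2 * z - 1, ?_⟩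
      rw [hA, hd', hw, hz]
      ring
  apply le_antisymm
  · apply Finset.card_le_card_of_injOn (fun v => v + Pi.single 2 (((2 ^ (n-1) : ℤ)) : ZMod (2 ^ (n+1))))
    · intro v hv
      exact hself _ _ (by simp) (by simp) v hv
    · intro v _ w _ h
      exact add_right_cancel h
  · apply Finset.card_le_card_of_injOn (fun v => v + Pi.single 2 (((2 ^ (n-1) : ℤ)) : ZMod (2 ^ (n+1))))
    · intro v hv
      exact hself _ _ (by simp) ⟨1, by ring⟩ v hv
    · intro v _ w _ h
      exact add_right_cancel h

def red (n : ℕ) : (Fin 3 → ZMod (2 ^ (n+1))) →+ (Fin 3 → ZMod (2 ^ n)) :=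
  (ZMod.castHom (pow_dvd_pow 2 (Nat.le_succ n)) (ZMod (2 ^ n))).toAddMonoidHom.compLeft (Fin 3)

lemma red_int (n : ℕ) (a : Fin 3 → ℤ) :
    red n (fun i => (a i : ZMod (2 ^ (n+1)))) = fun i => (a i : ZMod (2 ^ n)) := by
  funext i
  simp [red]

lemma red_surj (n : ℕ) : Function.Surjective (red n) := by
  intro v
  choose a ha using fun i => ZMod.intCast_surjective (v i)
  exact ⟨fun i => (a i : ZMod (2 ^ (n+1))), by rw [red_int]; exact funext ha⟩

open Classical in
lemma fib (n : ℕ) (y : Fin 3 → ZMod (2 ^ n)) :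
    (Finset.univ.filter (fun x => red n x = y)).card = 8 := by
  have h : ∀ z, (Finset.univ.filter (fun x => red n x = z)).card
      = (Finset.univ.filter (fun x => red n x = y)).card := fun z =>
    AddMonoidHom.card_fiber_eq_of_mem_range (red n) (red_surj n z) (red_surj n y)
  have h1 := Finset.card_eq_sum_card_fiberwise (f := red n) (s := Finset.univ)
    (t := Finset.univ) (by intro x _; simp)
  rw [Finset.sum_congr rfl (fun z _ => h z)] at h1
  simp only [Finset.sum_const, Finset.card_univ, Fintype.card_fun, ZMod.card, Fintype.card_fin, smul_eq_mul] at h1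
  have h2 : ((2:ℕ) ^ (n+1)) ^ 3 = (2 ^ n) ^ 3 * 8 := by ring
  rw [h2] at h1
  exact (Nat.eq_of_mul_eq_mul_left (by positivity) h1).symm

open Classical in
lemma step (t : ℤ) (ht : t ≡ 1 [ZMOD 4]) (n : ℕ) (hn : 3 ≤ n) :
    (SS t 0 (n+1)).card = 4 * (SS t 0 n).card := by
  have hA : ∀ v, v ∈ SS t 0 (n+1) ∪ SS t (2 ^ n) (n+1) ↔ red n v ∈ SS t 0 n := by
    intro v
    obtain ⟨a, rfl⟩ : ∃ a : Fin 3 → ℤ, v = fun i => (a i : ZMod (2 ^ (n+1))) := by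
      choose a ha using fun i => ZMod.intCast_surjective (v i)
      exact ⟨a, funext fun i => (ha i).symm⟩
    rw [red_int, Finset.mem_union, mem_int _ _ _ (by omega), mem_int _ _ _ (by omega),
      mem_int _ _ _ (by omega), ← and_or_left]
    refine and_congr Iff.rfl ?_
    constructor
    · rintro (⟨x, hx⟩ | ⟨x, hx⟩)
      · exact ⟨2 * x, by rw [hx]; ring⟩
      · exact ⟨2 * x + 1, by rw [pow_succ (2:ℤ) n] at hx; linarith⟩
    · rintro ⟨x, hx⟩
      rcases Int.even_or_odd' x with ⟨k, rfl | rfl⟩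
      · exact Or.inl ⟨k, by rw [hx]; ring⟩
      · exact Or.inr ⟨k, by rw [pow_succ (2:ℤ) n]; linarith⟩
  have hdisj : Disjoint (SS t 0 (n+1)) (SS t (2 ^ n) (n+1)) := by
    rw [Finset.disjoint_left]
    intro v h1 h2
    rw [mem_SS] at h1 h2
    have h3 := h1.2.symm.trans h2.2
    have h4 : (((2 ^ n : ℤ)) : ZMod (2 ^ (n+1))) = 0 := by rw [← h3]; simp
    rw [ZMod.intCast_zmod_eq_zero_iff_dvd] at h4
    have := Int.le_of_dvd (by positivity) h4
    push_cast at this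
    rw [pow_succ] at this
    have : (0:ℤ) < 2 ^ n := by positivity
    linarith
  have h1 := Finset.card_eq_sum_card_fiberwise (f := red n) (s := SS t 0 (n+1) ∪ SS t (2 ^ n) (n+1))
    (t := SS t 0 n) (by intro x hx; exact (hA x).1 hx)
  have h2 : ∀ y ∈ SS t 0 n, ((SS t 0 (n+1) ∪ SS t (2 ^ n) (n+1)).filter (fun x => red n x = y)).card = 8 := by
    intro y hy
    rw [← fib n y]
    congr 1
    ext x
    simp only [Finset.mem_filter, Finset.mem_univ, true_and]
    rw [hA]
    exact ⟨fun h => h.2, fun h => ⟨h ▸ hy, h⟩⟩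
  rw [Finset.sum_congr rfl h2, Finset.card_union_of_disjoint hdisj, ← step_card t ht n hn] at h1
  simp only [Finset.sum_const, smul_eq_mul] at h1
  omega

lemma N8 (t : ℤ) (ht : t ≡ 1 [ZMOD 4]) : Ncong t 8 = 64 := by
  have hd : ∀ x : ZMod 8, 2 ∣ x ↔ (x = 0 ∨ x = 2 ∨ x = 4 ∨ x = 6) := by
    intro x
    constructor
    · rintro ⟨c, rfl⟩; revert c; decide
    · rintro (rfl | rfl | rfl | rfl)
      exacts [⟨0, rfl⟩, ⟨1, rfl⟩, ⟨2, rfl⟩, ⟨3, rfl⟩]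
  have h8 : (t : ZMod 8) = 1 ∨ (t : ZMod 8) = 5 := by
    have : t % 8 = 1 ∨ t % 8 = 5 := by unfold Int.ModEq at ht; omega
    rcases this with h | h
    · left; exact_mod_cast (ZMod.intCast_eq_intCast_iff t 1 8).2 h
    · right; exact_mod_cast (ZMod.intCast_eq_intCast_iff t 5 8).2 h
  unfold Ncong
  simp only [hd]
  rcases h8 with h | h <;> rw [h, Nat.card_eq_fintype_card] <;> decide +kernel

/-- for odd `t ≡ 1 (mod 4)`, one has `N(2ⁿ) = 2^{2n-6}·N(8)`
for all `n ≥ 3`, `N(8) = 64`, and consequently `lim_{n→∞} N(2ⁿ)/2^{2n} = 1`. -/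
theorem statement_16
    (t : ℤ) (hodd : Odd t) (ht : t ≡ 1 [ZMOD 4]) :
    (∀ n : ℕ, 3 ≤ n → Ncong t (2 ^ n) = 2 ^ (2 * n - 6) * Ncong t 8) ∧
    Ncong t 8 = 64 ∧
    Tendsto (fun n : ℕ => (Ncong t (2 ^ n) : ℝ) / (2 : ℝ) ^ (2 * n)) atTop (𝓝 1) := by
  have key : ∀ n : ℕ, 3 ≤ n → Ncong t (2 ^ n) = 2 ^ (2 * n - 6) * Ncong t 8 := by
    intro n hn
    induction n, hn using Nat.le_induction with
    | base => norm_num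
    | succ n hn ih =>
      rw [Ncong_eq, step t ht n hn, ← Ncong_eq, ih]
      have : 2 * (n + 1) - 6 = (2 * n - 6) + 2 := by omega
      rw [this, pow_add]
      ring
  refine ⟨key, N8 t ht, ?_⟩
  refine tendsto_const_nhds.congr' ?_
  filter_upwards [eventually_ge_atTop 3] with n hn
  rw [key n hn, N8 t ht]
  obtain ⟨m, rfl⟩ : ∃ m, n = m + 3 := ⟨n - 3, by omega⟩
  have : 2 * (m + 3) - 6 = 2 * m := by omega
  rw [this, eq_div_iff (by positivity)]
  push_cast
  ring

end Stmt
end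
end
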